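/- arXiv:1808.03239 — 2 statements merged into one kernel-verified Lean document; each statement's English description precedes it below -/
import Mathlib

section
/- Fix x < 0 and let {X_t}_{t≥0} be the canonical Markov chain with transition kernel K_σ and X_0 = x, and let τ_x^{(σ)} = inf{t>0 : X_t ≥ 0}. Then for every ε > 0, lim_{σ→0} P[τ_x^{(σ)} < Φ_σ^{-(1+ε)}] = 1. -/
open MeasureTheory Filter Set

/-- Gaussian density `φ_σ` with mean 0 and variance `σ²`. -/
noncomputable def gaussDensity (σ x : ℝ) : ℝ :=
  (Real.sqrt (2 * Real.pi * σ ^ 2))⁻¹ * Real.exp (-(x ^ 2) / (2 * σ ^ 2))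

/-- Density `f_σ` of the mixture `½ N(-1,σ²) + ½ N(1,σ²)`. -/
noncomputable def mixDensity (σ x : ℝ) : ℝ :=
  (1 / 2) * gaussDensity σ (x + 1) + (1 / 2) * gaussDensity σ (x - 1)

/-- The random-walk Metropolis transition probability `K_σ(x, A)` (real-valued form):
`K_σ(x,A) = ∫ 1_A(x+z) min(1, f_σ(x+z)/f_σ(x)) φ_σ(z) dz
            + 1_A(x) (1 − ∫ min(1, f_σ(x+z)/f_σ(x)) φ_σ(z) dz)`. -/
noncomputable def rwmProb (σ x : ℝ) (A : Set ℝ) : ℝ :=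
  (∫ z, A.indicator (fun _ => (1 : ℝ)) (x + z)
      * min 1 (mixDensity σ (x + z) / mixDensity σ x) * gaussDensity σ z)
  + A.indicator (fun _ => (1 : ℝ)) x
      * (1 - ∫ z, min 1 (mixDensity σ (x + z) / mixDensity σ x) * gaussDensity σ z)

/-- The conductance `Φ_σ` of the half line `(-∞,0)`:
`Φ_σ = 2 ∫_{(-∞,0)} K_σ(x,[0,∞)) f_σ(x) dx`. -/
noncomputable def PhiHalf (σ : ℝ) : ℝ :=
  2 * ∫ x in Set.Iio (0 : ℝ), rwmProb σ x (Set.Ici 0) * mixDensity σ x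

/-- The `N(0,σ²)` measure, defined via its density `φ_σ` w.r.t. Lebesgue measure. -/
noncomputable def gaussMeasure (σ : ℝ) : Measure ℝ :=
  volume.withDensity fun z => ENNReal.ofReal (gaussDensity σ z)

/-- The random-walk Metropolis kernel `K_σ(x, ·)` as a measure: the accepted-move part
has density `min(1, f_σ(y)/f_σ(x))` w.r.t. the proposal `x + N(0,σ²)`, and the
remaining mass `1 − ∫ min(1, f_σ(x+z)/f_σ(x)) φ_σ(z) dz` stays at `x`. -/
noncomputable def rwmKernel (σ : ℝ) (x : ℝ) : Measure ℝ :=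
  ((gaussMeasure σ).map (fun z => x + z)).withDensity
      (fun y => ENNReal.ofReal (min 1 (mixDensity σ y / mixDensity σ x)))
  + (ENNReal.ofReal
      (1 - ∫ z, min 1 (mixDensity σ (x + z) / mixDensity σ x) * gaussDensity σ z))
      • Measure.dirac x

/-- The restricted Metropolis–Hastings kernel `K̂_σ` on `(-∞,0)`:
`K̂_σ(x,A) = K_σ(x, A ∩ (-∞,0)) + 1_A(x) K_σ(x,[0,∞))`. -/
noncomputable def rwmKernelHat (σ : ℝ) (x : ℝ) : Measure ℝ :=
  (rwmKernel σ x).restrict (Set.Iio 0) + (rwmKernel σ x (Set.Ici 0)) • Measure.dirac x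

/-- `P` is the law on trajectory space (as produced by the Ionescu–Tulcea construction)
of the Markov chain with transition kernel `κ` started at `x`: a probability measure
with `X 0 = x` a.s. such that, conditionally on the first `n+1` coordinates,
`X (n+1)` has law `κ (X n)`. -/
def IsMarkovChainLaw {α : Type*} [MeasurableSpace α] (κ : α → Measure α) (x : α)
    (P : Measure (ℕ → α)) : Prop :=
  IsProbabilityMeasure P ∧ P {ω | ω 0 = x} = 1 ∧
  ∀ (n : ℕ) (A : Set (ℕ → α)),
    MeasurableSet[MeasurableSpace.comap (fun ω (i : Fin (n + 1)) => ω i.1) inferInstance] A →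
    ∀ B : Set α, MeasurableSet B →
      P (A ∩ {ω | ω (n + 1) ∈ B}) = ∫⁻ ω in A, κ (ω n) B ∂P

/-! ### The densities -/

lemma gaussDensity_eq_gaussianPDFReal (σ x : ℝ) :
    gaussDensity σ x = ProbabilityTheory.gaussianPDFReal 0 (σ ^ 2).toNNReal x := by
  simp [gaussDensity, ProbabilityTheory.gaussianPDFReal, sq_nonneg]

lemma gaussDensity_pos {σ : ℝ} (hσ : 0 < σ) (x : ℝ) : 0 < gaussDensity σ x := by
  have := Real.pi_pos
  unfold gaussDensity
  positivity

lemma gaussDensity_eq {σ : ℝ} (hσ : 0 < σ) (x : ℝ) :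
    gaussDensity σ x
      = (Real.sqrt (2 * Real.pi))⁻¹ * σ⁻¹ * Real.exp (-(x ^ 2) / (2 * σ ^ 2)) := by
  rw [gaussDensity, Real.sqrt_mul (by positivity), Real.sqrt_sq hσ.le, mul_inv]

lemma continuous_gaussDensity (σ : ℝ) : Continuous (gaussDensity σ) := by
  unfold gaussDensity
  fun_prop

lemma gaussDensity_neg (σ x : ℝ) : gaussDensity σ (-x) = gaussDensity σ x := by
  simp [gaussDensity]

lemma integrable_gaussDensity (σ : ℝ) : Integrable (gaussDensity σ) := by
  rw [funext (gaussDensity_eq_gaussianPDFReal σ)]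
  exact ProbabilityTheory.integrable_gaussianPDFReal _ _

lemma integral_gaussDensity {σ : ℝ} (hσ : 0 < σ) : ∫ z, gaussDensity σ z = 1 := by
  rw [funext (gaussDensity_eq_gaussianPDFReal σ)]
  exact ProbabilityTheory.integral_gaussianPDFReal_eq_one _ (by simpa using hσ.ne')

lemma gaussDensity_le_of_sq_le {σ x y : ℝ} (h : y ^ 2 ≤ x ^ 2) :
    gaussDensity σ x ≤ gaussDensity σ y := by
  unfold gaussDensity
  gcongr

lemma gaussDensity_le_zero (σ x : ℝ) : gaussDensity σ x ≤ gaussDensity σ 0 :=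
  gaussDensity_le_of_sq_le (by simpa using sq_nonneg x)

lemma exp_div_le_gaussDensity {σ : ℝ} (hσ : 0 < σ) (z : ℝ) :
    Real.exp (-1 - z ^ 2 / (2 * σ ^ 2)) * σ⁻¹ ≤ gaussDensity σ z := by
  have h2 : Real.sqrt (2 * Real.pi) ≤ Real.exp 1 := by
    rw [Real.sqrt_le_left (Real.exp_pos 1).le]
    nlinarith [Real.exp_one_gt_d9, Real.pi_lt_d2]
  have h3 : Real.exp (-1) ≤ (Real.sqrt (2 * Real.pi))⁻¹ := by
    rw [Real.exp_neg]
    have := Real.pi_pos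
    gcongr
  rw [gaussDensity_eq hσ, sub_eq_add_neg, Real.exp_add, ← neg_div]
  calc _ = Real.exp (-1) * σ⁻¹ * Real.exp (-z ^ 2 / (2 * σ ^ 2)) := by ring
    _ ≤ _ := by gcongr

lemma mixDensity_pos {σ : ℝ} (hσ : 0 < σ) (x : ℝ) : 0 < mixDensity σ x := by
  have := gaussDensity_pos hσ (x + 1)
  have := gaussDensity_pos hσ (x - 1)
  unfold mixDensity
  positivity

lemma continuous_mixDensity (σ : ℝ) : Continuous (mixDensity σ) := by
  have := continuous_gaussDensity σ
  unfold mixDensity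
  fun_prop

lemma half_gaussDensity_add_le {σ : ℝ} (hσ : 0 < σ) (x : ℝ) :
    1 / 2 * gaussDensity σ (x + 1) ≤ mixDensity σ x := by
  have := gaussDensity_pos hσ (x - 1)
  unfold mixDensity
  linarith

lemma half_gaussDensity_sub_le {σ : ℝ} (hσ : 0 < σ) (x : ℝ) :
    1 / 2 * gaussDensity σ (x - 1) ≤ mixDensity σ x := by
  have := gaussDensity_pos hσ (x + 1)
  unfold mixDensity
  linarith

lemma mixDensity_le_of_nonpos {σ x : ℝ} (hx : x ≤ 0) :
    mixDensity σ x ≤ gaussDensity σ (x + 1) := by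
  have : gaussDensity σ (x - 1) ≤ gaussDensity σ (x + 1) :=
    gaussDensity_le_of_sq_le (by nlinarith)
  unfold mixDensity
  linarith

lemma mixDensity_le_of_nonneg {σ x : ℝ} (hx : 0 ≤ x) :
    mixDensity σ x ≤ gaussDensity σ (x - 1) := by
  have : gaussDensity σ (x + 1) ≤ gaussDensity σ (x - 1) :=
    gaussDensity_le_of_sq_le (by nlinarith)
  unfold mixDensity
  linarith

/-- Moving to the right, the mixture decreases at most as fast as its left component. -/
lemma exp_mul_mixDensity_le {σ : ℝ} (hσ : 0 < σ) (y : ℝ) {w : ℝ} (hw : y ≤ w) :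
    Real.exp (((y + 1) ^ 2 - (w + 1) ^ 2) / (2 * σ ^ 2)) * mixDensity σ y ≤ mixDensity σ w := by
  have key : ∀ u v : ℝ, v ^ 2 ≤ u ^ 2 - ((y + 1) ^ 2 - (w + 1) ^ 2) →
      Real.exp (((y + 1) ^ 2 - (w + 1) ^ 2) / (2 * σ ^ 2)) * gaussDensity σ u
        ≤ gaussDensity σ v := by
    intro u v h
    rw [gaussDensity, gaussDensity, mul_left_comm, ← Real.exp_add, ← add_div]
    gcongr
    linarith
  have h1 := key (y + 1) (w + 1) (by linarith)
  have h2 := key (y - 1) (w - 1) (by nlinarith)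
  unfold mixDensity
  linarith

lemma lintegral_exp_neg_sq {s : ℝ} (hs : 0 < s) (m : ℝ) :
    ∫⁻ x, ENNReal.ofReal (Real.exp (-(x - m) ^ 2 / (2 * s ^ 2)))
      = ENNReal.ofReal (Real.sqrt (2 * Real.pi) * s) := by
  rw [lintegral_sub_right_eq_self
    (fun x : ℝ => ENNReal.ofReal (Real.exp (-x ^ 2 / (2 * s ^ 2)))) m]
  have he : (fun x : ℝ => Real.exp (-x ^ 2 / (2 * s ^ 2)))
      = fun x => Real.exp (-(1 / (2 * s ^ 2)) * x ^ 2) := by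
    ext x
    congr 1
    ring
  rw [← ofReal_integral_eq_lintegral_ofReal _ (.of_forall fun _ => (Real.exp_pos _).le)]
  · rw [he, integral_gaussian]
    congr 1
    rw [div_div_eq_mul_div, div_one, ← mul_assoc, Real.sqrt_mul (by positivity),
      Real.sqrt_sq hs.le]
    ring_nf
  · rw [he]
    exact integrable_exp_neg_mul_sq (by positivity)

/-! ### The kernel -/

/-- Density of the accepted part of the Metropolis kernel. -/
noncomputable def acceptDensity (σ y w : ℝ) : ℝ :=
  min 1 (mixDensity σ w / mixDensity σ y) * gaussDensity σ (w - y)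

/-- Probability that the Metropolis chain rejects the proposal made from `y`. -/
noncomputable def holdProb (σ y : ℝ) : ℝ :=
  1 - ∫ z, min 1 (mixDensity σ (y + z) / mixDensity σ y) * gaussDensity σ z

lemma acceptDensity_nonneg {σ : ℝ} (hσ : 0 < σ) (y w : ℝ) : 0 ≤ acceptDensity σ y w := by
  have := mixDensity_pos hσ w
  have := mixDensity_pos hσ y
  have := gaussDensity_pos hσ (w - y)
  unfold acceptDensity
  positivity

lemma acceptDensity_le {σ : ℝ} (hσ : 0 < σ) (y w : ℝ) :
    acceptDensity σ y w ≤ gaussDensity σ (w - y) :=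
  mul_le_of_le_one_left (gaussDensity_pos hσ _).le (min_le_left _ _)

lemma acceptDensity_mul {σ : ℝ} (hσ : 0 < σ) (y w : ℝ) :
    acceptDensity σ y w * mixDensity σ y
      = min (mixDensity σ y) (mixDensity σ w) * gaussDensity σ (w - y) := by
  have h := mixDensity_pos hσ y
  rw [acceptDensity, mul_right_comm, min_mul_of_nonneg _ _ h.le, one_mul,
    div_mul_cancel₀ _ h.ne']

/-- Detailed balance. -/
lemma acceptDensity_mul_comm {σ : ℝ} (hσ : 0 < σ) (y w : ℝ) :
    acceptDensity σ y w * mixDensity σ y = acceptDensity σ w y * mixDensity σ w := by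
  rw [acceptDensity_mul hσ, acceptDensity_mul hσ, min_comm, ← gaussDensity_neg σ (w - y), neg_sub]

lemma continuous_acceptDensity {σ : ℝ} (hσ : 0 < σ) :
    Continuous fun p : ℝ × ℝ => acceptDensity σ p.1 p.2 := by
  have h1 := continuous_mixDensity σ
  have h2 := continuous_gaussDensity σ
  have h3 : ∀ p : ℝ × ℝ, mixDensity σ p.1 ≠ 0 := fun p => (mixDensity_pos hσ _).ne'
  unfold acceptDensity
  fun_prop (disch := exact h3 _)

lemma integrable_acceptDensity {σ : ℝ} (hσ : 0 < σ) (y : ℝ) : Integrable (acceptDensity σ y) := by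
  refine ((integrable_gaussDensity σ).comp_sub_right y).mono'
    ((continuous_acceptDensity hσ).comp (by fun_prop : Continuous fun w : ℝ => (y, w))
      |>.aestronglyMeasurable) (.of_forall fun w => ?_)
  rw [Real.norm_of_nonneg (acceptDensity_nonneg hσ y w)]
  exact acceptDensity_le hσ y w

lemma holdProb_eq (σ y : ℝ) : holdProb σ y = 1 - ∫ w, acceptDensity σ y w := by
  rw [holdProb, ← integral_sub_right_eq_self _ y]
  simp [acceptDensity]

lemma integral_acceptDensity_le_one {σ : ℝ} (hσ : 0 < σ) (y : ℝ) :
    ∫ w, acceptDensity σ y w ≤ 1 := by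
  rw [← integral_gaussDensity hσ, ← integral_sub_right_eq_self (gaussDensity σ) y]
  exact integral_mono (integrable_acceptDensity hσ y)
    ((integrable_gaussDensity σ).comp_sub_right y) (acceptDensity_le hσ y)

lemma holdProb_le_one {σ : ℝ} (hσ : 0 < σ) (y : ℝ) : holdProb σ y ≤ 1 := by
  rw [holdProb_eq, sub_le_self_iff]
  exact integral_nonneg (acceptDensity_nonneg hσ y)

lemma lintegral_acceptDensity_add_holdProb {σ : ℝ} (hσ : 0 < σ) (y : ℝ) :
    (∫⁻ w, ENNReal.ofReal (acceptDensity σ y w)) + ENNReal.ofReal (holdProb σ y) = 1 := by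
  rw [← ofReal_integral_eq_lintegral_ofReal (integrable_acceptDensity hσ y)
    (.of_forall (acceptDensity_nonneg hσ y)), holdProb_eq,
    ← ENNReal.ofReal_add (integral_nonneg (acceptDensity_nonneg hσ y))
      (sub_nonneg.2 (integral_acceptDensity_le_one hσ y))]
  simp

lemma measurable_acceptDensity {σ : ℝ} (hσ : 0 < σ) :
    Measurable fun p : ℝ × ℝ => ENNReal.ofReal (acceptDensity σ p.1 p.2) :=
  (continuous_acceptDensity hσ).measurable.ennreal_ofReal

lemma measurable_acceptDensity_right {σ : ℝ} (hσ : 0 < σ) (y : ℝ) :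
    Measurable fun w => ENNReal.ofReal (acceptDensity σ y w) :=
  ((continuous_acceptDensity hσ).comp (Continuous.prodMk_right y)).measurable.ennreal_ofReal

lemma measurable_holdProb {σ : ℝ} (hσ : 0 < σ) : Measurable (holdProb σ) := by
  rw [funext (holdProb_eq σ)]
  have h : StronglyMeasurable (Function.uncurry (acceptDensity σ)) :=
    (continuous_acceptDensity hσ).stronglyMeasurable
  exact measurable_const.sub h.integral_prod_right.measurable

lemma rwmKernel_eq {σ : ℝ} (hσ : 0 < σ) (y : ℝ) :
    rwmKernel σ y = volume.withDensity (fun w => ENNReal.ofReal (acceptDensity σ y w))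
      + ENNReal.ofReal (holdProb σ y) • Measure.dirac y := by
  rw [rwmKernel, holdProb]
  congr 1
  have hg : Measurable fun w => ENNReal.ofReal (min 1 (mixDensity σ w / mixDensity σ y)) := by
    have := continuous_mixDensity σ
    fun_prop
  have hφ : Measurable fun z => ENNReal.ofReal (gaussDensity σ z) :=
    (continuous_gaussDensity σ).measurable.ennreal_ofReal
  ext B hB
  have hgB : Measurable fun z => B.indicator
      (fun w => ENNReal.ofReal (min 1 (mixDensity σ w / mixDensity σ y))) (y + z) :=
    (hg.indicator hB).comp (measurable_const_add y)
  rw [withDensity_apply _ hB, withDensity_apply _ hB, ← lintegral_indicator hB,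
    lintegral_map (hg.indicator hB) (by fun_prop), gaussMeasure,
    lintegral_withDensity_eq_lintegral_mul _ hφ hgB,
    ← lintegral_indicator hB, ← lintegral_sub_right_eq_self _ y]
  congr 1 with w
  simp only [Pi.mul_apply, add_sub_cancel]
  by_cases hw : w ∈ B
  · simp only [Set.indicator_of_mem hw, acceptDensity]
    rw [mul_comm, ← ENNReal.ofReal_mul]
    have := mixDensity_pos hσ w
    have := mixDensity_pos hσ y
    positivity
  · simp [hw]

lemma rwmKernel_apply {σ : ℝ} (hσ : 0 < σ) (y : ℝ) {B : Set ℝ} (hB : MeasurableSet B) :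
    rwmKernel σ y B = (∫⁻ w in B, ENNReal.ofReal (acceptDensity σ y w))
      + ENNReal.ofReal (holdProb σ y) * B.indicator 1 y := by
  rw [rwmKernel_eq hσ, Measure.add_apply, withDensity_apply _ hB, Measure.smul_apply,
    Measure.dirac_apply' _ hB, smul_eq_mul]

lemma measurable_rwmKernel {σ : ℝ} (hσ : 0 < σ) : Measurable (rwmKernel σ) := by
  refine Measure.measurable_of_measurable_coe _ fun B hB => ?_
  simp_rw [rwmKernel_apply hσ _ hB]
  exact (measurable_acceptDensity hσ).lintegral_prod_right' (ν := volume.restrict B) |>.add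
    ((measurable_holdProb hσ).ennreal_ofReal.mul (measurable_one.indicator hB))

lemma measurable_rwmKernel_apply {σ : ℝ} (hσ : 0 < σ) {B : Set ℝ} (hB : MeasurableSet B) :
    Measurable fun y => rwmKernel σ y B :=
  (Measure.measurable_coe hB).comp (measurable_rwmKernel hσ)

/-- The target distribution `π_σ`. -/
noncomputable def mixMeasure (σ : ℝ) : Measure ℝ :=
  volume.withDensity fun y => ENNReal.ofReal (mixDensity σ y)

lemma measurable_ofReal_mixDensity (σ : ℝ) :
    Measurable fun y => ENNReal.ofReal (mixDensity σ y) :=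
  (continuous_mixDensity σ).measurable.ennreal_ofReal

/-- `π_σ` is invariant under the Metropolis kernel. -/
lemma bind_mixMeasure {σ : ℝ} (hσ : 0 < σ) :
    (mixMeasure σ).bind (rwmKernel σ) = mixMeasure σ := by
  have hf := measurable_ofReal_mixDensity σ
  have hF := measurable_acceptDensity hσ
  have hfH : Measurable fun y => ENNReal.ofReal (mixDensity σ y) * ENNReal.ofReal (holdProb σ y) :=
    hf.mul (measurable_holdProb hσ).ennreal_ofReal
  ext B hB
  rw [Measure.bind_apply hB (measurable_rwmKernel hσ).aemeasurable, mixMeasure,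
    lintegral_withDensity_eq_lintegral_mul _ hf (measurable_rwmKernel_apply hσ hB),
    withDensity_apply _ hB]
  have hsymm : ∀ y w : ℝ, ENNReal.ofReal (mixDensity σ y) * ENNReal.ofReal (acceptDensity σ y w)
      = ENNReal.ofReal (mixDensity σ w) * ENNReal.ofReal (acceptDensity σ w y) := by
    intro y w
    rw [← ENNReal.ofReal_mul (mixDensity_pos hσ y).le,
      ← ENNReal.ofReal_mul (mixDensity_pos hσ w).le, mul_comm, acceptDensity_mul_comm hσ, mul_comm]
  have hmove : ∫⁻ y, ENNReal.ofReal (mixDensity σ y)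
        * ∫⁻ w in B, ENNReal.ofReal (acceptDensity σ y w)
      = ∫⁻ w in B, ENNReal.ofReal (mixDensity σ w)
        * ∫⁻ y, ENNReal.ofReal (acceptDensity σ w y) := by
    have hc : ∀ (y : ℝ) (μ : Measure ℝ),
        ENNReal.ofReal (mixDensity σ y) * ∫⁻ w, ENNReal.ofReal (acceptDensity σ y w) ∂μ
          = ∫⁻ w, ENNReal.ofReal (mixDensity σ y) * ENNReal.ofReal (acceptDensity σ y w) ∂μ :=
      fun y μ => (lintegral_const_mul _ (measurable_acceptDensity_right hσ y)).symm
    simp_rw [hc]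
    rw [lintegral_lintegral_swap ((hf.comp measurable_fst).mul hF).aemeasurable]
    exact lintegral_congr fun w => lintegral_congr fun y => hsymm y w
  calc _ = ∫⁻ y, (ENNReal.ofReal (mixDensity σ y)
              * (∫⁻ w in B, ENNReal.ofReal (acceptDensity σ y w))
            + B.indicator (fun y => ENNReal.ofReal (mixDensity σ y)
              * ENNReal.ofReal (holdProb σ y)) y) := by
        congr 1 with y
        rw [Pi.mul_apply, rwmKernel_apply hσ y hB, mul_add]
        by_cases hy : y ∈ B <;> simp [hy]
    _ = ∫⁻ w in B, (ENNReal.ofReal (mixDensity σ w)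
              * (∫⁻ y, ENNReal.ofReal (acceptDensity σ w y))
            + ENNReal.ofReal (mixDensity σ w) * ENNReal.ofReal (holdProb σ w)) := by
        rw [lintegral_add_right _ (hfH.indicator hB), hmove, lintegral_indicator hB,
          ← lintegral_add_right _ hfH]
    _ = _ := by
        simp_rw [← mul_add, lintegral_acceptDensity_add_holdProb hσ, mul_one]

lemma rwmKernel_le {σ : ℝ} (hσ : 0 < σ) (x : ℝ) :
    rwmKernel σ x ≤ Measure.dirac x
      + ENNReal.ofReal (gaussDensity σ 0 / mixDensity σ x) • mixMeasure σ := by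
  rw [rwmKernel_eq hσ, add_comm (Measure.dirac x)]
  gcongr ?_ + ?_
  · rw [mixMeasure, ← withDensity_smul _ (measurable_ofReal_mixDensity σ)]
    refine withDensity_mono (.of_forall fun w => ?_)
    simp only [Pi.smul_apply, smul_eq_mul]
    have h0 := gaussDensity_pos hσ 0
    have h1 := mixDensity_pos hσ x
    have h2 := mixDensity_pos hσ w
    rw [← ENNReal.ofReal_mul (by positivity)]
    refine ENNReal.ofReal_le_ofReal ?_
    calc acceptDensity σ x w ≤ mixDensity σ w / mixDensity σ x * gaussDensity σ 0 :=
          mul_le_mul (min_le_right _ _) (gaussDensity_le_zero _ _) (gaussDensity_pos hσ _).le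
            (by positivity)
      _ = _ := by ring
  · refine Measure.le_iff.2 fun B _ => ?_
    rw [Measure.smul_apply, smul_eq_mul]
    exact mul_le_of_le_one_left' (ENNReal.ofReal_le_one.2 (holdProb_le_one hσ x))

/-! ### The conductance -/

lemma rwmProb_Ici {σ : ℝ} (hσ : 0 < σ) {y : ℝ} (hy : y < 0) :
    rwmProb σ y (Set.Ici 0) = (rwmKernel σ y (Set.Ici 0)).toReal := by
  have hy' : y ∉ Set.Ici (0 : ℝ) := not_le.2 hy
  rw [rwmKernel_apply hσ y measurableSet_Ici, rwmProb, Set.indicator_of_notMem hy',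
    Set.indicator_of_notMem hy', zero_mul, mul_zero, add_zero, add_zero,
    ← integral_eq_lintegral_of_nonneg_ae (.of_forall (acceptDensity_nonneg hσ y))
      (integrable_acceptDensity hσ y).aestronglyMeasurable.restrict,
    ← integral_indicator measurableSet_Ici, ← integral_sub_right_eq_self _ y]
  congr 1 with w
  rw [add_sub_cancel, mul_assoc]
  by_cases hw : w ∈ Set.Ici (0 : ℝ)
  · simp [Set.indicator_of_mem hw, acceptDensity]
  · simp [Set.indicator_of_notMem hw]

/-- Stationary flux across the origin, i.e. half of the conductance. -/
noncomputable def flux (σ : ℝ) : ENNReal :=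
  ∫⁻ y in Set.Iio 0, rwmKernel σ y (Set.Ici 0) * ENNReal.ofReal (mixDensity σ y)

lemma rwmKernel_univ {σ : ℝ} (hσ : 0 < σ) (y : ℝ) : rwmKernel σ y Set.univ = 1 := by
  rw [rwmKernel_apply hσ y MeasurableSet.univ, Measure.restrict_univ, Set.indicator_univ,
    Pi.one_apply, mul_one, lintegral_acceptDensity_add_holdProb hσ]

lemma rwmKernel_ne_top {σ : ℝ} (hσ : 0 < σ) (y : ℝ) (B : Set ℝ) : rwmKernel σ y B ≠ ⊤ :=
  ((measure_mono (Set.subset_univ B)).trans_lt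
    ((rwmKernel_univ hσ y).trans_lt ENNReal.one_lt_top)).ne

lemma PhiHalf_eq {σ : ℝ} (hσ : 0 < σ) : PhiHalf σ = 2 * (flux σ).toReal := by
  rw [PhiHalf, flux]
  congr 1
  have hm : Measurable fun y => (rwmKernel σ y (Set.Ici 0)).toReal * mixDensity σ y :=
    (measurable_rwmKernel_apply hσ measurableSet_Ici).ennreal_toReal.mul
      (continuous_mixDensity σ).measurable
  rw [setIntegral_congr_fun measurableSet_Iio fun y hy => by rw [rwmProb_Ici hσ hy],
    integral_eq_lintegral_of_nonneg_ae (.of_forall fun y =>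
      mul_nonneg ENNReal.toReal_nonneg (mixDensity_pos hσ y).le) hm.aestronglyMeasurable]
  congr 1
  refine lintegral_congr fun y => ?_
  rw [ENNReal.ofReal_mul ENNReal.toReal_nonneg, ENNReal.ofReal_toReal (rwmKernel_ne_top hσ _ _)]

lemma acceptDensity_mul_le {σ : ℝ} (hσ : 0 < σ) {y w : ℝ} (hy : y < 0) (hw : 0 ≤ w) :
    acceptDensity σ y w * mixDensity σ y
      ≤ (2 * Real.pi * σ ^ 2)⁻¹ * Real.exp (-(2 / 5) / σ ^ 2)
        * Real.exp (-(y - (-1 / 5)) ^ 2 / (2 * (Real.sqrt 2 * σ) ^ 2))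
        * Real.exp (-(w - (y + 2 / 5)) ^ 2 / (2 * σ ^ 2)) := by
  set C := (Real.sqrt (2 * Real.pi))⁻¹ * σ⁻¹ with hC
  have hC0 : 0 ≤ C := by positivity
  have hCC : (2 * Real.pi * σ ^ 2)⁻¹ = C * C := by
    have : Real.sqrt (2 * Real.pi) ^ 2 = 2 * Real.pi := Real.sq_sqrt (by positivity)
    rw [mul_inv, ← this, hC]
    ring
  have hexp : -((y + 1) ^ 2 + (w - 1) ^ 2) / (4 * σ ^ 2)
      = -((y + 1) ^ 2 + (w - 1) ^ 2) / 2 / (2 * σ ^ 2) := by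
    rw [div_div]
    ring_nf
  have hmin : min (mixDensity σ y) (mixDensity σ w)
      ≤ C * Real.exp (-((y + 1) ^ 2 + (w - 1) ^ 2) / (4 * σ ^ 2)) := by
    rcases le_total ((y + 1) ^ 2) ((w - 1) ^ 2) with h | h
    · refine (min_le_right _ _).trans ((mixDensity_le_of_nonneg hw).trans ?_)
      rw [gaussDensity_eq hσ, hexp]
      gcongr ?_ * Real.exp (?_ / _)
      linarith
    · refine (min_le_left _ _).trans ((mixDensity_le_of_nonpos hy.le).trans ?_)
      rw [gaussDensity_eq hσ, hexp]
      gcongr ?_ * Real.exp (?_ / _)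
      linarith
  rw [acceptDensity_mul hσ, gaussDensity_eq hσ (w - y), ← hC, hCC, mul_pow, Real.sq_sqrt (by simp)]
  calc _ ≤ C * Real.exp (-((y + 1) ^ 2 + (w - 1) ^ 2) / (4 * σ ^ 2))
        * (C * Real.exp (-(w - y) ^ 2 / (2 * σ ^ 2))) := by gcongr
    _ = C * C * Real.exp ((-((y + 1) ^ 2 + (w - 1) ^ 2) / 4 - (w - y) ^ 2 / 2) / σ ^ 2) := by
        rw [mul_mul_mul_comm, ← Real.exp_add]
        congr 2
        field_simp
        ring
    _ ≤ C * C * Real.exp ((-(2 / 5) - (y - (-1 / 5)) ^ 2 / 4 - (w - (y + 2 / 5)) ^ 2 / 2)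
          / σ ^ 2) := by
        gcongr ?_ * Real.exp (?_ / _)
        nlinarith [sq_nonneg ((y + 1 / 5) + (w - y - 2 / 5))]
    _ = _ := by
        rw [mul_assoc (C * C * _), mul_assoc (C * C), ← Real.exp_add, ← Real.exp_add]
        congr 2
        field_simp
        ring

lemma flux_le {σ : ℝ} (hσ : 0 < σ) :
    flux σ ≤ ENNReal.ofReal (Real.sqrt 2 * Real.exp (-(2 / 5) / σ ^ 2)) := by
  set A := (2 * Real.pi * σ ^ 2)⁻¹ * Real.exp (-(2 / 5) / σ ^ 2) with hA
  have hA0 : 0 ≤ A := by positivity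
  set g : ℝ → ℝ := fun y => Real.exp (-(y - (-1 / 5)) ^ 2 / (2 * (Real.sqrt 2 * σ) ^ 2)) with hg
  have hg0 : ∀ y, 0 ≤ g y := fun y => (Real.exp_pos _).le
  have hgm : Measurable fun y => ENNReal.ofReal (g y) := by fun_prop
  have hinner : ∀ y ∈ Set.Iio (0 : ℝ),
      rwmKernel σ y (Set.Ici 0) * ENNReal.ofReal (mixDensity σ y)
        ≤ ENNReal.ofReal (A * (Real.sqrt (2 * Real.pi) * σ)) * ENNReal.ofReal (g y) := by
    intro y hy
    rw [rwmKernel_apply hσ y measurableSet_Ici,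
      Set.indicator_of_notMem (show y ∉ Set.Ici 0 from not_le.2 (Set.mem_Iio.1 hy)),
      mul_zero, add_zero, ← lintegral_mul_const _ (measurable_acceptDensity_right hσ y)]
    calc _ ≤ ∫⁻ w in Set.Ici 0, ENNReal.ofReal (A * g y)
              * ENNReal.ofReal (Real.exp (-(w - (y + 2 / 5)) ^ 2 / (2 * σ ^ 2))) := by
          refine setLIntegral_mono' measurableSet_Ici fun w hw => ?_
          rw [← ENNReal.ofReal_mul (acceptDensity_nonneg hσ y w),
            ← ENNReal.ofReal_mul (mul_nonneg hA0 (hg0 y))]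
          exact ENNReal.ofReal_le_ofReal (acceptDensity_mul_le hσ hy hw)
      _ ≤ ∫⁻ w, ENNReal.ofReal (A * g y)
              * ENNReal.ofReal (Real.exp (-(w - (y + 2 / 5)) ^ 2 / (2 * σ ^ 2))) :=
          setLIntegral_le_lintegral _ _
      _ = _ := by
          rw [lintegral_const_mul _ (by fun_prop), lintegral_exp_neg_sq hσ,
            ← ENNReal.ofReal_mul (mul_nonneg hA0 (hg0 y)), ← ENNReal.ofReal_mul (by positivity)]
          ring_nf
  calc flux σ ≤ ∫⁻ y, ENNReal.ofReal (A * (Real.sqrt (2 * Real.pi) * σ)) * ENNReal.ofReal (g y) :=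
        (setLIntegral_mono' measurableSet_Iio hinner).trans (setLIntegral_le_lintegral _ _)
    _ = _ := by
        rw [lintegral_const_mul _ hgm, lintegral_exp_neg_sq (by positivity),
          ← ENNReal.ofReal_mul (by positivity)]
        congr 1
        have : Real.sqrt (2 * Real.pi) * Real.sqrt (2 * Real.pi) = 2 * Real.pi :=
          Real.mul_self_sqrt (by positivity)
        calc _ = A * (Real.sqrt (2 * Real.pi) * Real.sqrt (2 * Real.pi)) * σ ^ 2 * Real.sqrt 2 := by
              ring
          _ = _ := by
              rw [this, hA]
              have := Real.pi_pos
              field_simp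

/-! ### Climbing from the left mode to the origin -/

/-- Probability of crossing the origin in one step from `[-1/5, 0)`. -/
lemma ofReal_exp_le_rwmKernel {σ : ℝ} (hσ : 0 < σ) (hσ1 : σ ≤ 1) {y : ℝ}
    (hy : y ∈ Set.Ico (-1 / 5) 0) :
    ENNReal.ofReal (Real.exp (-2 - (2 / 5 + σ) ^ 2 / (2 * σ ^ 2)))
      ≤ rwmKernel σ y (Set.Ici 0) := by
  obtain ⟨hy1, hy2⟩ := hy
  set c := Real.exp (-2 - (2 / 5 + σ) ^ 2 / (2 * σ ^ 2)) with hc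
  have hacc : ∀ w ∈ Set.Icc (1 / 5) (1 / 5 + σ), c * σ⁻¹ ≤ acceptDensity σ y w := by
    rintro w ⟨hw1, hw2⟩
    have hmy := mixDensity_pos hσ y
    have hmw := mixDensity_pos hσ w
    have hhalf : Real.exp (-1) ≤ min 1 (mixDensity σ w / mixDensity σ y) := by
      have h2 : Real.exp (-1) ≤ 1 / 2 := by
        rw [Real.exp_neg, ← one_div]
        gcongr
        linarith [Real.exp_one_gt_d9]
      refine le_min (by linarith) (h2.trans ?_)
      rw [le_div_iff₀ hmy]
      refine le_trans ?_ (half_gaussDensity_sub_le hσ w)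
      gcongr
      exact (mixDensity_le_of_nonpos hy2.le).trans (gaussDensity_le_of_sq_le (by nlinarith))
    have hφ : Real.exp (-1 - (2 / 5 + σ) ^ 2 / (2 * σ ^ 2)) * σ⁻¹ ≤ gaussDensity σ (w - y) := by
      refine le_trans ?_ (exp_div_le_gaussDensity hσ (w - y))
      gcongr <;> linarith
    calc c * σ⁻¹ = Real.exp (-1) * (Real.exp (-1 - (2 / 5 + σ) ^ 2 / (2 * σ ^ 2)) * σ⁻¹) := by
          rw [← mul_assoc, ← Real.exp_add, hc]
          ring_nf
      _ ≤ _ := by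
          unfold acceptDensity
          gcongr
  calc ENNReal.ofReal c = ∫⁻ _ in Set.Icc (1 / 5) (1 / 5 + σ), ENNReal.ofReal (c * σ⁻¹) := by
        rw [setLIntegral_const, Real.volume_Icc, ← ENNReal.ofReal_mul (by positivity)]
        congr 1
        field_simp
        ring
    _ ≤ ∫⁻ w in Set.Icc (1 / 5) (1 / 5 + σ), ENNReal.ofReal (acceptDensity σ y w) :=
        setLIntegral_mono' measurableSet_Icc fun w hw => ENNReal.ofReal_le_ofReal (hacc w hw)
    _ ≤ ∫⁻ w in Set.Ici 0, ENNReal.ofReal (acceptDensity σ y w) :=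
        lintegral_mono_set fun w hw => Set.mem_Ici.2 (by linarith [hw.1])
    _ ≤ _ := by
        rw [rwmKernel_apply hσ y measurableSet_Ici]
        exact le_self_add

/-- Monotone potential of the left component: it vanishes to the left of the mode `-1`. -/
noncomputable def climbPotential (σ y : ℝ) : ℝ := max (y + 1) 0 ^ 2 / (2 * σ ^ 2)

lemma climbPotential_nonneg (σ y : ℝ) : 0 ≤ climbPotential σ y := by
  unfold climbPotential
  positivity

lemma climbPotential_mono (σ : ℝ) : Monotone (climbPotential σ) := by
  intro y w h
  unfold climbPotential
  gcongr

lemma exp_sub_climbPotential_le {σ : ℝ} (hσ : 0 < σ) {y w : ℝ} (h : y ≤ w) :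
    Real.exp (climbPotential σ y - climbPotential σ w)
      ≤ min 1 (mixDensity σ w / mixDensity σ y) := by
  refine le_min (Real.exp_le_one_iff.2 (sub_nonpos.2 (climbPotential_mono σ h))) ?_
  rw [le_div_iff₀ (mixDensity_pos hσ y)]
  rcases le_total 0 (w + 1) with hw | hw
  · refine le_trans ?_ (exp_mul_mixDensity_le hσ y h)
    have := (mixDensity_pos hσ y).le
    rw [climbPotential, climbPotential, ← sub_div]
    gcongr Real.exp ((?_ - ?_) / _) * _
    · rcases le_total 0 (y + 1) with hy | hy
      · rw [max_eq_left hy]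
      · simpa [max_eq_right hy] using sq_nonneg (y + 1)
    · gcongr
      exact le_max_left _ _
  · have hy : y + 1 ≤ 0 := by linarith
    rw [climbPotential, climbPotential, max_eq_right hw, max_eq_right hy, sub_self, Real.exp_zero,
      one_mul]
    refine le_trans (le_mul_of_one_le_left (mixDensity_pos hσ y).le ?_)
      (exp_mul_mixDensity_le hσ y h)
    refine Real.one_le_exp (div_nonneg ?_ (by positivity))
    nlinarith

lemma ofReal_exp_le_lintegral_rwmKernel {σ : ℝ} (hσ : 0 < σ) {y c : ℝ} (hy : y + 2 * σ < 0)
    {H : ℝ → ENNReal} (hHm : Measurable H)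
    (hH : ∀ w ∈ Set.Icc (y + σ) (y + 2 * σ),
      ENNReal.ofReal (Real.exp (c + climbPotential σ w)) ≤ H w) :
    ENNReal.ofReal (Real.exp (c - 3 + climbPotential σ y))
      ≤ ∫⁻ w in Set.Iio 0, H w ∂rwmKernel σ y := by
  have hacc : ∀ w ∈ Set.Icc (y + σ) (y + 2 * σ),
      Real.exp (c - 3 + climbPotential σ y) * σ⁻¹
        ≤ acceptDensity σ y w * Real.exp (c + climbPotential σ w) := by
    rintro w ⟨hw1, hw2⟩
    have hφ : Real.exp (-3) * σ⁻¹ ≤ gaussDensity σ (w - y) := by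
      refine le_trans ?_ (exp_div_le_gaussDensity hσ (w - y))
      gcongr
      rw [le_sub_comm, div_le_iff₀ (by positivity)]
      nlinarith
    have hmy := mixDensity_pos hσ y
    have hmw := mixDensity_pos hσ w
    have h1 := exp_sub_climbPotential_le hσ (show y ≤ w by linarith)
    calc _ = Real.exp (climbPotential σ y - climbPotential σ w) * (Real.exp (-3) * σ⁻¹)
            * Real.exp (c + climbPotential σ w) := by
          rw [← mul_assoc, mul_right_comm _ σ⁻¹, ← Real.exp_add, ← Real.exp_add]
          ring_nf
      _ ≤ _ := by
          unfold acceptDensity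
          gcongr
  have hF := measurable_acceptDensity_right hσ y
  calc _ = ∫⁻ _ in Set.Icc (y + σ) (y + 2 * σ),
        ENNReal.ofReal (Real.exp (c - 3 + climbPotential σ y) * σ⁻¹) := by
        rw [setLIntegral_const, Real.volume_Icc, ← ENNReal.ofReal_mul (by positivity)]
        congr 1
        field_simp
        ring
    _ ≤ ∫⁻ w in Set.Icc (y + σ) (y + 2 * σ), ENNReal.ofReal (acceptDensity σ y w) * H w := by
        refine setLIntegral_mono' measurableSet_Icc fun w hw =>
          le_trans (ENNReal.ofReal_le_ofReal (hacc w hw)) ?_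
        rw [ENNReal.ofReal_mul (acceptDensity_nonneg hσ y w)]
        gcongr
        exact hH w hw
    _ ≤ ∫⁻ w in Set.Iio 0, ENNReal.ofReal (acceptDensity σ y w) * H w :=
        lintegral_mono_set fun w hw => Set.mem_Iio.2 (by linarith [hw.2])
    _ = ∫⁻ w in Set.Iio 0, H w
          ∂volume.withDensity (fun w => ENNReal.ofReal (acceptDensity σ y w)) :=
        (setLIntegral_withDensity_eq_setLIntegral_mul _ hF hHm measurableSet_Iio).symm
    _ ≤ _ := by
        rw [rwmKernel_eq hσ]
        exact lintegral_mono' (Measure.restrict_mono_measure (Measure.le_add_right le_rfl) _) le_rfl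

/-- Lower bound for the probability of crossing the origin within `n + 1` steps. -/
noncomputable def climbBound (σ : ℝ) (n : ℕ) : ℝ → ENNReal :=
  (Set.Ico (-1 / 5 - n * σ) 0).indicator fun y =>
    ENNReal.ofReal (Real.exp (-3 * n + (-2 - (2 / 5 + σ) ^ 2 / (2 * σ ^ 2))
      + min (climbPotential σ y - climbPotential σ (-1 / 5 + 2 * σ)) 0))

lemma measurable_climbBound (σ : ℝ) (n : ℕ) : Measurable (climbBound σ n) := by
  have : Measurable (climbPotential σ) := (climbPotential_mono σ).measurable
  unfold climbBound
  exact Measurable.indicator (by fun_prop) measurableSet_Ico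

lemma climbBound_le_of_mem {σ : ℝ} (hσ : 0 < σ) (hσ1 : σ ≤ 1) (n : ℕ) {y : ℝ}
    (hy : y ∈ Set.Ico (-1 / 5) 0) : climbBound σ n y ≤ rwmKernel σ y (Set.Ici 0) := by
  refine le_trans ?_ (ofReal_exp_le_rwmKernel hσ hσ1 hy)
  refine Set.indicator_apply_le' (fun _ => ?_) fun _ => zero_le
  gcongr
  have := min_le_right (climbPotential σ y - climbPotential σ (-1 / 5 + 2 * σ)) 0
  have : (0 : ℝ) ≤ n := n.cast_nonneg
  linarith

lemma climbBound_zero_le {σ : ℝ} (hσ : 0 < σ) (hσ1 : σ ≤ 1) (y : ℝ) :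
    climbBound σ 0 y ≤ rwmKernel σ y (Set.Ici 0) := by
  by_cases hy : y ∈ Set.Ico (-1 / 5) (0 : ℝ)
  · exact climbBound_le_of_mem hσ hσ1 0 hy
  · rw [climbBound, Set.indicator_of_notMem (by simpa using hy)]
    exact zero_le

lemma climbBound_succ_le {σ : ℝ} (hσ : 0 < σ) (hσ1 : σ < 1 / 10) (n : ℕ) (y : ℝ) :
    climbBound σ (n + 1) y
      ≤ rwmKernel σ y (Set.Ici 0) + ∫⁻ w in Set.Iio 0, climbBound σ n w ∂rwmKernel σ y := by
  by_cases hy : y ∈ Set.Ico (-1 / 5) (0 : ℝ)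
  · exact (climbBound_le_of_mem hσ (by linarith) _ hy).trans le_self_add
  refine le_trans ?_ le_add_self
  refine Set.indicator_apply_le' (fun hy' => ?_) fun _ => zero_le
  have hy5 : y < -1 / 5 := by
    by_contra h
    exact hy ⟨not_lt.1 h, hy'.2⟩
  have hyn := hy'.1
  push_cast at hyn
  generalize hd : -2 - (2 / 5 + σ) ^ 2 / (2 * σ ^ 2) = d
  rw [min_eq_left (sub_nonpos.2 (climbPotential_mono σ (by linarith)))]
  have key := ofReal_exp_le_lintegral_rwmKernel hσ (y := y)
    (c := -3 * n + d - climbPotential σ (-1 / 5 + 2 * σ)) (by linarith)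
    (measurable_climbBound σ n) ?_
  · refine le_trans (le_of_eq ?_) key
    push_cast
    ring_nf
  · rintro w ⟨hw1, hw2⟩
    rw [climbBound, Set.indicator_of_mem (Set.mem_Ico.2 ⟨by linarith, by linarith⟩), hd,
      min_eq_left (sub_nonpos.2 (climbPotential_mono σ (by linarith)))]
    refine le_of_eq ?_
    ring_nf

lemma flux_pos {σ : ℝ} (hσ : 0 < σ) (hσ1 : σ ≤ 1) : 0 < flux σ := by
  have hm : Measurable fun y => rwmKernel σ y (Set.Ici 0) * ENNReal.ofReal (mixDensity σ y) :=
    (measurable_rwmKernel_apply hσ measurableSet_Ici).mul (measurable_ofReal_mixDensity σ)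
  rw [flux, setLIntegral_pos_iff hm]
  refine lt_of_lt_of_le (b := volume (Set.Ico (-1 / 5 : ℝ) 0)) (by norm_num) (measure_mono ?_)
  refine fun y hy => ⟨(ENNReal.mul_pos ?_ ?_).ne', hy.2⟩
  · exact (lt_of_lt_of_le (ENNReal.ofReal_pos.2 (Real.exp_pos _))
      (ofReal_exp_le_rwmKernel hσ hσ1 hy)).ne'
  · exact (ENNReal.ofReal_pos.2 (mixDensity_pos hσ y)).ne'

lemma PhiHalf_pos {σ : ℝ} (hσ : 0 < σ) (hσ1 : σ ≤ 1) : 0 < PhiHalf σ := by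
  rw [PhiHalf_eq hσ]
  have := ENNReal.toReal_pos (flux_pos hσ hσ1).ne'
    ((flux_le hσ).trans_lt ENNReal.ofReal_lt_top).ne
  positivity

lemma PhiHalf_le {σ : ℝ} (hσ : 0 < σ) : PhiHalf σ ≤ 3 * Real.exp (-(2 / 5) / σ ^ 2) := by
  rw [PhiHalf_eq hσ]
  have h1 : (flux σ).toReal ≤ Real.sqrt 2 * Real.exp (-(2 / 5) / σ ^ 2) :=
    ENNReal.toReal_le_of_le_ofReal (by positivity) (flux_le hσ)
  have h2 : Real.sqrt 2 ≤ 3 / 2 := by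
    rw [Real.sqrt_le_left (by norm_num)]
    norm_num
  nlinarith [Real.exp_pos (-(2 / 5) / σ ^ 2)]

/-! ### The chain killed at the origin -/

/-- Trajectories which stay in `(-∞, 0)` during the times `1, …, t`. -/
def staysNegative (t : ℕ) : Set (ℕ → ℝ) := {ω | ∀ s, 0 < s → s ≤ t → ω s < 0}

/-- Law at time `t` of the chain killed when it enters `[0, ∞)`. -/
noncomputable def killedLaw (P : Measure (ℕ → ℝ)) (t : ℕ) : Measure ℝ :=
  (P.restrict (staysNegative t)).map fun ω => ω t

lemma measurableSet_comap_staysNegative (t : ℕ) :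
    MeasurableSet[MeasurableSpace.comap (fun (ω : ℕ → ℝ) (i : Fin (t + 1)) => ω i.1) inferInstance]
      (staysNegative t) := by
  refine ⟨⋂ i : Fin (t + 1), {v | 0 < i.1 → v i < 0}, ?_, ?_⟩
  · refine MeasurableSet.iInter fun i => ?_
    by_cases hi : 0 < i.1
    · simpa [hi] using measurableSet_lt (measurable_pi_apply i) measurable_const
    · simp [hi]
  · ext ω
    simp only [staysNegative, Set.mem_preimage, Set.mem_iInter, Set.mem_ofPred_eq]
    exact ⟨fun h s hs hst => h ⟨s, by omega⟩ hs, fun h i hi => h i.1 hi (by omega)⟩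

lemma measurableSet_staysNegative (t : ℕ) : MeasurableSet (staysNegative t) := by
  refine (Measurable.comap_le ?_) _ (measurableSet_comap_staysNegative t)
  exact measurable_pi_lambda _ fun i => measurable_pi_apply i.1

lemma staysNegative_succ (t : ℕ) :
    staysNegative (t + 1) = staysNegative t ∩ {ω | ω (t + 1) ∈ Set.Iio 0} := by
  ext ω
  simp only [staysNegative, Set.mem_inter_iff, Set.mem_ofPred_eq, Set.mem_Iio]
  refine ⟨fun h => ⟨fun s hs hst => h s hs (by omega), h _ (by omega) le_rfl⟩, ?_⟩
  rintro ⟨h1, h2⟩ s hs hst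
  rcases hst.lt_or_eq with h | rfl
  · exact h1 s hs (by omega)
  · exact h2

lemma killedLaw_apply (P : Measure (ℕ → ℝ)) (t : ℕ) {B : Set ℝ} (hB : MeasurableSet B) :
    killedLaw P t B = P (staysNegative t ∩ {ω | ω t ∈ B}) := by
  rw [killedLaw, Measure.map_apply (measurable_pi_apply t) hB,
    Measure.restrict_apply (measurable_pi_apply t hB), Set.inter_comm]
  rfl

lemma killedLaw_univ (P : Measure (ℕ → ℝ)) (t : ℕ) :
    killedLaw P t Set.univ = P (staysNegative t) := by
  simp [killedLaw_apply]

section MarkovChain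

variable {κ : ℝ → Measure ℝ} {x : ℝ} {P : Measure (ℕ → ℝ)}

lemma bind_killedLaw_apply (hP : IsMarkovChainLaw κ x P) (hκ : Measurable κ) (t : ℕ) {B : Set ℝ}
    (hB : MeasurableSet B) :
    (killedLaw P t).bind κ B = P (staysNegative t ∩ {ω | ω (t + 1) ∈ B}) := by
  have hκB : Measurable fun y => κ y B := (Measure.measurable_coe hB).comp hκ
  rw [hP.2.2 t _ (measurableSet_comap_staysNegative t) B hB,
    Measure.bind_apply hB hκ.aemeasurable, killedLaw, lintegral_map hκB (measurable_pi_apply t)]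

lemma killedLaw_zero (hP : IsMarkovChainLaw κ x P) : killedLaw P 0 = Measure.dirac x := by
  have := hP.1
  have hS : staysNegative 0 = Set.univ := by
    ext ω
    simp only [staysNegative, Set.mem_ofPred_eq, Set.mem_univ, iff_true]
    intro s hs hs'
    omega
  have hae : (fun ω : ℕ → ℝ => ω 0) =ᵐ[P] fun _ => x := by
    have hm : MeasurableSet {ω : ℕ → ℝ | ω 0 = x} :=
      measurableSet_eq_fun (measurable_pi_apply 0) measurable_const
    exact (prob_compl_eq_zero_iff hm).2 hP.2.1
  rw [killedLaw, hS, Measure.restrict_univ, Measure.map_congr hae, Measure.map_const,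
    measure_univ, one_smul]

lemma killedLaw_succ (hP : IsMarkovChainLaw κ x P) (hκ : Measurable κ) (t : ℕ) :
    killedLaw P (t + 1) = ((killedLaw P t).bind κ).restrict (Set.Iio 0) := by
  ext B hB
  rw [Measure.restrict_apply hB, bind_killedLaw_apply hP hκ t (hB.inter measurableSet_Iio),
    killedLaw_apply P _ hB, staysNegative_succ, Set.inter_assoc]
  congr 2
  ext ω
  simp [and_comm]

lemma killedLaw_univ_eq_add (hP : IsMarkovChainLaw κ x P) (hκ : Measurable κ) (t : ℕ) :
    killedLaw P t Set.univ
      = killedLaw P (t + 1) Set.univ + (killedLaw P t).bind κ (Set.Ici 0) := by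
  have hm : MeasurableSet {ω : ℕ → ℝ | ω (t + 1) ∈ Set.Iio 0} :=
    measurable_pi_apply (t + 1) measurableSet_Iio
  rw [killedLaw_univ, killedLaw_univ, bind_killedLaw_apply hP hκ t measurableSet_Ici,
    staysNegative_succ, ← measure_inter_add_sdiff (staysNegative t) hm]
  congr 2
  ext ω
  simp

lemma killedLaw_Ici (hP : IsMarkovChainLaw κ x P) (hκ : Measurable κ) (hx : x < 0) (t : ℕ) :
    killedLaw P t (Set.Ici 0) = 0 := by
  cases t with
  | zero => simp [killedLaw_zero hP, hx]
  | succ t =>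
    rw [killedLaw_succ hP hκ, Measure.restrict_apply measurableSet_Ici, Set.Ici_inter_Iio,
      Set.Ico_self, measure_empty]

lemma killedLaw_univ_antitone (P : Measure (ℕ → ℝ)) :
    Antitone fun t => killedLaw P t Set.univ := by
  intro s t hst
  simp only [killedLaw_univ]
  exact measure_mono fun ω hω r hr hrs => hω r hr (hrs.trans hst)

/-- Multi-step lower bound for the mass lost by the killed chain. -/
lemma killedLaw_univ_add_lintegral_le (hP : IsMarkovChainLaw κ x P) (hκ : Measurable κ)
    {H : ℕ → ℝ → ENNReal} (hHm : ∀ n, Measurable (H n)) (h0 : ∀ y, H 0 y ≤ κ y (Set.Ici 0))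
    (hs : ∀ n y, H (n + 1) y ≤ κ y (Set.Ici 0) + ∫⁻ w in Set.Iio 0, H n w ∂κ y) (n t : ℕ) :
    killedLaw P (t + n + 1) Set.univ + ∫⁻ y, H n y ∂killedLaw P t
      ≤ killedLaw P t Set.univ := by
  have hκI : Measurable fun y => κ y (Set.Ici 0) :=
    (Measure.measurable_coe measurableSet_Ici).comp hκ
  induction n generalizing t with
  | zero =>
    rw [killedLaw_univ_eq_add hP hκ t, Measure.bind_apply measurableSet_Ici hκ.aemeasurable]
    gcongr
    exact h0 _
  | succ n ih =>
    have h1 : ∫⁻ y, H (n + 1) y ∂killedLaw P t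
        ≤ (killedLaw P t).bind κ (Set.Ici 0) + ∫⁻ y, H n y ∂killedLaw P (t + 1) := by
      rw [killedLaw_succ hP hκ, Measure.bind_apply measurableSet_Ici hκ.aemeasurable,
        ← lintegral_indicator measurableSet_Iio,
        Measure.lintegral_bind hκ.aemeasurable
          ((hHm n).indicator measurableSet_Iio).aemeasurable, ← lintegral_add_left hκI]
      refine lintegral_mono fun y => ?_
      rw [lintegral_indicator measurableSet_Iio]
      exact hs n y
    calc _ ≤ killedLaw P (t + (n + 1) + 1) Set.univ
          + ((killedLaw P t).bind κ (Set.Ici 0) + ∫⁻ y, H n y ∂killedLaw P (t + 1)) := by gcongr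
      _ = (killedLaw P (t + 1 + n + 1) Set.univ + ∫⁻ y, H n y ∂killedLaw P (t + 1))
          + (killedLaw P t).bind κ (Set.Ici 0) := by
          rw [show t + (n + 1) + 1 = t + 1 + n + 1 by ring]
          ring
      _ ≤ killedLaw P (t + 1) Set.univ + (killedLaw P t).bind κ (Set.Ici 0) := by
          gcongr
          exact ih (t + 1)
      _ = _ := (killedLaw_univ_eq_add hP hκ t).symm

/-- If `π` is invariant and `κ x` is dominated by `δ_x + c π`, then so are the laws of the killed
chain, with a constant growing linearly in time. -/
lemma killedLaw_le (hP : IsMarkovChainLaw κ x P) (hκ : Measurable κ) {π : Measure ℝ}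
    (hπ : π.bind κ = π) {c : ENNReal} (hx : κ x ≤ Measure.dirac x + c • π) (t : ℕ) :
    killedLaw P t ≤ Measure.dirac x + ((t : ENNReal) * c) • π := by
  induction t with
  | zero => simp [killedLaw_zero hP]
  | succ t ih =>
    rw [killedLaw_succ hP hκ]
    refine Measure.restrict_le_self.trans (Measure.le_iff.2 fun B hB => ?_)
    have hκB : Measurable fun y => κ y B := (Measure.measurable_coe hB).comp hκ
    rw [Measure.bind_apply hB hκ.aemeasurable]
    calc _ ≤ ∫⁻ y, κ y B ∂(Measure.dirac x + ((t : ENNReal) * c) • π) := lintegral_mono' ih le_rfl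
      _ = κ x B + t * c * π B := by
          rw [lintegral_add_measure, lintegral_dirac' _ hκB, lintegral_smul_measure,
            ← Measure.bind_apply hB hκ.aemeasurable, hπ, smul_eq_mul]
      _ ≤ (Measure.dirac x + c • π) B + t * c * π B := by
          gcongr
      _ = _ := by
          simp only [Measure.add_apply, Measure.smul_apply, smul_eq_mul]
          push_cast
          ring_nf

/-- If every block of `m` steps kills a proportion `p` of the mass, up to an error `p * r`, then
after `k` blocks at most `r + 1 / (k * p)` of the mass is left. -/
lemma toReal_killedLaw_univ_le (hP : IsMarkovChainLaw κ x P) {m k : ℕ} {p r : ℝ} (hp : 0 < p)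
    (hk : 0 < k)
    (h : ∀ t ≤ m * k, (killedLaw P (t + m) Set.univ).toReal
      + p * ((killedLaw P t Set.univ).toReal - r) ≤ (killedLaw P t Set.univ).toReal) :
    (P (staysNegative (m * k))).toReal ≤ r + 1 / (k * p) := by
  have := hP.1
  rw [← killedLaw_univ]
  set a : ℕ → ℝ := fun t => (killedLaw P t Set.univ).toReal with ha
  have ha_anti : Antitone a := fun s t hst =>
    ENNReal.toReal_mono (by simp [killedLaw_univ]) (killedLaw_univ_antitone P hst)
  have ha0 : ∀ t, 0 ≤ a t := fun t => ENNReal.toReal_nonneg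
  have ha1 : a 0 ≤ 1 := by
    simp only [ha, killedLaw_univ]
    exact measureReal_le_one
  have key : ∀ j ≤ k, j * p * a (m * j) ≤ 1 - a (m * j) + j * p * r := by
    intro j
    induction j with
    | zero =>
      intro _
      simpa using ha1
    | succ j ih =>
      intro hj
      have h1 := ih (by omega)
      have h2 : a (m * j + m) + p * (a (m * j) - r) ≤ a (m * j) := h _ (by gcongr; omega)
      have h3 : a (m * (j + 1)) ≤ a (m * j) := ha_anti (by gcongr; omega)
      rw [show m * j + m = m * (j + 1) by ring] at h2
      push_cast
      nlinarith [mul_le_mul_of_nonneg_left h3 (show 0 ≤ ((j : ℝ) + 1) * p by positivity)]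
  have hkp : 0 < (k : ℝ) * p := by positivity
  have := key k le_rfl
  rw [← sub_le_iff_le_add', le_div_iff₀ hkp]
  have := ha0 (m * k)
  simp only [ha] at *
  linarith

end MarkovChain

/-! ### Confinement -/

lemma mixMeasure_Iio_le {σ : ℝ} (hσ : 0 < σ) {b : ℝ} (hb : 0 ≤ b) :
    mixMeasure σ (Set.Iio (-(1 + 2 * b)))
      ≤ ENNReal.ofReal (Real.sqrt 2 * Real.exp (-b ^ 2 / σ ^ 2)) := by
  set C := (Real.sqrt (2 * Real.pi))⁻¹ * σ⁻¹ * Real.exp (-b ^ 2 / σ ^ 2) with hC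
  have hC0 : 0 ≤ C := by positivity
  rw [mixMeasure, withDensity_apply _ measurableSet_Iio]
  calc _ ≤ ∫⁻ y in Set.Iio (-(1 + 2 * b)), ENNReal.ofReal C
          * ENNReal.ofReal (Real.exp (-(y - (-1)) ^ 2 / (2 * (Real.sqrt 2 * σ) ^ 2))) := by
        refine setLIntegral_mono' measurableSet_Iio fun y hy => ?_
        rw [Set.mem_Iio] at hy
        rw [← ENNReal.ofReal_mul hC0]
        refine ENNReal.ofReal_le_ofReal ((mixDensity_le_of_nonpos (by linarith)).trans ?_)
        rw [gaussDensity_eq hσ, hC, mul_assoc _ (Real.exp _), ← Real.exp_add]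
        have h2 : -(y + 1) ^ 2 / (2 * σ ^ 2)
            = (-(y + 1) ^ 2 / 4 - (y + 1) ^ 2 / 4) / σ ^ 2 := by
          field_simp
          ring
        have h3 : -b ^ 2 / σ ^ 2 + -(y - (-1)) ^ 2 / (2 * (Real.sqrt 2 * σ) ^ 2)
            = (-b ^ 2 - (y + 1) ^ 2 / 4) / σ ^ 2 := by
          rw [mul_pow, Real.sq_sqrt (by simp)]
          field_simp
          ring
        rw [h2, h3]
        gcongr ?_ * Real.exp ((?_ - ?_) / _)
        nlinarith
    _ ≤ ∫⁻ y, ENNReal.ofReal C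
          * ENNReal.ofReal (Real.exp (-(y - (-1)) ^ 2 / (2 * (Real.sqrt 2 * σ) ^ 2))) :=
        setLIntegral_le_lintegral _ _
    _ = _ := by
        rw [lintegral_const_mul _ (by fun_prop), lintegral_exp_neg_sq (by positivity),
          ← ENNReal.ofReal_mul hC0, hC]
        congr 1
        have := Real.pi_pos
        field_simp

lemma gaussDensity_zero_div_le {σ : ℝ} (hσ : 0 < σ) (x : ℝ) :
    gaussDensity σ 0 / mixDensity σ x ≤ 2 * Real.exp ((x + 1) ^ 2 / 2 / σ ^ 2) := by
  rw [div_le_iff₀ (mixDensity_pos hσ x)]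
  have h := half_gaussDensity_add_le hσ x
  have h0 : gaussDensity σ 0
      = 2 * Real.exp ((x + 1) ^ 2 / 2 / σ ^ 2) * (1 / 2 * gaussDensity σ (x + 1)) := by
    have he : Real.exp ((x + 1) ^ 2 / 2 / σ ^ 2) * Real.exp (-(x + 1) ^ 2 / (2 * σ ^ 2)) = 1 := by
      rw [← Real.exp_add, Real.exp_eq_one_iff]
      field_simp
      ring
    rw [gaussDensity_eq hσ, gaussDensity_eq hσ]
    simp only [ne_eq, OfNat.ofNat_ne_zero, not_false_eq_true, zero_pow, neg_zero, zero_div,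
      Real.exp_zero]
    linear_combination (-(Real.sqrt (2 * Real.pi))⁻¹ * σ⁻¹) * he
  rw [h0]
  gcongr

/-- Non-asymptotic bound for the probability of not having crossed the origin. -/
lemma toReal_staysNegative_le {σ x b : ℝ} (hσ : 0 < σ) (hσ1 : σ < 1 / 10) (hx : x < 0)
    (hb : 0 ≤ b) (hxb : -(1 + 2 * b) ≤ x) {P : Measure (ℕ → ℝ)}
    (hP : IsMarkovChainLaw (rwmKernel σ) x P) {n k : ℕ} (hk : 0 < k) (hn : 1 + 2 * b ≤ n * σ) :
    (P (staysNegative ((n + 1) * k))).toReal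
      ≤ ((n + 1) * k : ℝ) * (3 * Real.exp (((x + 1) ^ 2 / 2 - b ^ 2) / σ ^ 2))
        + 1 / (k * Real.exp (-(2 / 5) / σ ^ 2 - 2 / σ - 3 * n - 9 / 2)) := by
  have := hP.1
  have hκ := measurable_rwmKernel hσ
  set p := Real.exp (-(2 / 5) / σ ^ 2 - 2 / σ - 3 * n - 9 / 2) with hp
  set E := 3 * Real.exp (((x + 1) ^ 2 / 2 - b ^ 2) / σ ^ 2) with hE
  refine toReal_killedLaw_univ_le hP (Real.exp_pos _) hk fun t ht => ?_
  set ν := killedLaw P t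
  have hfin : ∀ s, killedLaw P s Set.univ ≠ ⊤ := fun s => by simp [killedLaw_univ]
  have hfinB : ∀ B, ν B ≠ ⊤ := fun B =>
    ((measure_mono (Set.subset_univ B)).trans_lt (hfin t).lt_top).ne
  have htail : (ν (Set.Iio (-(1 + 2 * b)))).toReal ≤ ((n + 1) * k : ℝ) * E := by
    refine ENNReal.toReal_le_of_le_ofReal (by positivity) ?_
    calc ν (Set.Iio (-(1 + 2 * b)))
        ≤ (Measure.dirac x + ((t : ENNReal) * ENNReal.ofReal (gaussDensity σ 0 / mixDensity σ x))
            • mixMeasure σ) (Set.Iio (-(1 + 2 * b))) :=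
          killedLaw_le hP hκ (bind_mixMeasure hσ) (rwmKernel_le hσ x) t _
      _ = ENNReal.ofReal t * ENNReal.ofReal (gaussDensity σ 0 / mixDensity σ x)
            * mixMeasure σ (Set.Iio (-(1 + 2 * b))) := by
          rw [Measure.add_apply, Measure.dirac_apply' _ measurableSet_Iio,
            Set.indicator_of_notMem (fun h => absurd (Set.mem_Iio.1 h) (not_lt.2 hxb)), zero_add,
            Measure.smul_apply, smul_eq_mul, ENNReal.ofReal_natCast]
      _ ≤ ENNReal.ofReal ((n + 1) * k)
            * ENNReal.ofReal (2 * Real.exp ((x + 1) ^ 2 / 2 / σ ^ 2))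
            * ENNReal.ofReal (Real.sqrt 2 * Real.exp (-b ^ 2 / σ ^ 2)) := by
          gcongr
          · exact_mod_cast ht
          · exact gaussDensity_zero_div_le hσ x
          · exact mixMeasure_Iio_le hσ hb
      _ ≤ _ := by
          rw [← ENNReal.ofReal_mul (by positivity), ← ENNReal.ofReal_mul (by positivity), mul_assoc]
          refine ENNReal.ofReal_le_ofReal (mul_le_mul_of_nonneg_left ?_ (by positivity))
          have h2 : Real.sqrt 2 ≤ 3 / 2 := by
            rw [Real.sqrt_le_left (by norm_num)]
            norm_num
          rw [hE, sub_div, sub_eq_add_neg, ← neg_div, Real.exp_add]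
          have : 0 < Real.exp ((x + 1) ^ 2 / 2 / σ ^ 2) * Real.exp (-b ^ 2 / σ ^ 2) := by
            positivity
          nlinarith
  have hmid : ENNReal.ofReal p * ν (Set.Ico (-(1 + 2 * b)) 0) ≤ ∫⁻ y, climbBound σ n y ∂ν := by
    rw [← setLIntegral_const]
    refine (setLIntegral_mono' measurableSet_Ico fun y hy => ?_).trans
      (setLIntegral_le_lintegral (Set.Ico (-(1 + 2 * b)) 0) _)
    rw [climbBound, Set.indicator_of_mem (Set.mem_Ico.2 ⟨by linarith [hy.1], hy.2⟩)]
    refine ENNReal.ofReal_le_ofReal (Real.exp_le_exp.2 ?_)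
    have hU : -climbPotential σ (-1 / 5 + 2 * σ)
        ≤ min (climbPotential σ y - climbPotential σ (-1 / 5 + 2 * σ)) 0 :=
      le_min (by linarith [climbPotential_nonneg σ y])
        (by linarith [climbPotential_nonneg σ (-1 / 5 + 2 * σ)])
    refine le_trans (le_of_eq ?_) (add_le_add_right hU _)
    rw [climbPotential, max_eq_left (by linarith)]
    field_simp
    ring
  have hmain := killedLaw_univ_add_lintegral_le hP hκ (measurable_climbBound σ)
    (climbBound_zero_le hσ (by linarith)) (climbBound_succ_le hσ hσ1) n t
  rw [add_assoc] at hmain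
  have hp0 : 0 ≤ p := (Real.exp_pos _).le
  have hmain' : (killedLaw P (t + (n + 1)) Set.univ).toReal
      + p * (ν (Set.Ico (-(1 + 2 * b)) 0)).toReal ≤ (ν Set.univ).toReal := by
    rw [← ENNReal.toReal_ofReal hp0, ← ENNReal.toReal_mul,
      ← ENNReal.toReal_add (hfin _) (ENNReal.mul_ne_top ENNReal.ofReal_ne_top (hfinB _))]
    refine ENNReal.toReal_mono (hfin t) (le_trans ?_ hmain)
    gcongr
  have hsplit : (ν Set.univ).toReal
      ≤ (ν (Set.Iio (-(1 + 2 * b)))).toReal + (ν (Set.Ico (-(1 + 2 * b)) 0)).toReal := by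
    rw [← ENNReal.toReal_add (hfinB _) (hfinB _)]
    refine ENNReal.toReal_mono (ENNReal.add_ne_top.2 ⟨hfinB _, hfinB _⟩) ?_
    have hcover : (Set.univ : Set ℝ)
        ⊆ (Set.Iio (-(1 + 2 * b)) ∪ Set.Ico (-(1 + 2 * b)) 0) ∪ Set.Ici 0 := by
      rw [Set.Iio_union_Ico_eq_Iio (by linarith), Set.Iio_union_Ici]
    calc ν Set.univ ≤ ν (Set.Iio (-(1 + 2 * b)) ∪ Set.Ico (-(1 + 2 * b)) 0) + ν (Set.Ici 0) :=
          (measure_mono hcover).trans (measure_union_le _ _)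
      _ ≤ _ := by
          rw [killedLaw_Ici hP hκ hx, add_zero]
          exact measure_union_le _ _
  nlinarith [mul_le_mul_of_nonneg_left (hsplit.trans (add_le_add_left htail _)) hp0]

/-! ### Asymptotics -/

lemma tendsto_exp_neg_sq_add {δ : ℝ} (hδ : 0 < δ) (a b : ℝ) :
    Tendsto (fun L : ℝ => Real.exp (-δ * L ^ 2 + a * L + b)) atTop (nhds 0) := by
  refine Real.tendsto_exp_atBot.comp (tendsto_atBot_add_const_right _ _ ?_)
  have h1 : Tendsto (fun L : ℝ => -δ * L + a) atTop atBot :=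
    tendsto_atBot_add_const_right _ _ (tendsto_id.const_mul_atTop_of_neg (neg_neg_of_pos hδ))
  refine (tendsto_id.atTop_mul_atBot₀ h1).congr fun L => ?_
  simp only [id]
  ring

lemma tendsto_linear_mul_exp_neg_sq {δ a b : ℝ} (hδ : 0 < δ) (ha : 0 ≤ a) (hb : 0 ≤ b) :
    Tendsto (fun L : ℝ => (a * L + b) * Real.exp (-δ * L ^ 2)) atTop (nhds 0) := by
  refine squeeze_zero' ?_ ?_ (tendsto_exp_neg_sq_add hδ a b)
  · filter_upwards [eventually_ge_atTop 0] with L hL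
    positivity
  · refine .of_forall fun L => ?_
    rw [add_assoc, Real.exp_add, mul_comm]
    gcongr
    linarith [Real.add_one_le_exp (a * L + b)]

lemma le_PhiHalf_rpow {σ ε : ℝ} (hσ : 0 < σ) (hσ1 : σ ≤ 1) (hε : 0 < ε) :
    ((3 : ℝ) ^ (1 + ε))⁻¹ * Real.exp ((2 / 5 + 2 / 5 * ε) * σ⁻¹ ^ 2)
      ≤ PhiHalf σ ^ (-(1 + ε)) := by
  refine le_trans (le_of_eq ?_)
    (Real.rpow_le_rpow_of_nonpos (PhiHalf_pos hσ hσ1) (PhiHalf_le hσ) (by linarith))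
  rw [Real.mul_rpow (by norm_num) (Real.exp_pos _).le, Real.rpow_neg (by norm_num),
    ← Real.exp_mul]
  congr 2
  field_simp

/-- For the random-walk Metropolis chain started at a fixed `x < 0`, the hitting time
`τ_x^{(σ)} = inf{t > 0 : X_t ≥ 0}` satisfies `P[τ_x^{(σ)} < Φ_σ^{-(1+ε)}] → 1` as `σ → 0`. -/
theorem stmt3 (x : ℝ) (hx : x < 0) (ε : ℝ) (hε : 0 < ε)
    (P : ℝ → Measure (ℕ → ℝ))
    (hP : ∀ σ : ℝ, 0 < σ → IsMarkovChainLaw (rwmKernel σ) x (P σ)) :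
    Filter.Tendsto
      (fun σ : ℝ =>
        (P σ {ω | ∃ t : ℕ, 0 < t ∧ (t : ℝ) < PhiHalf σ ^ (-(1 + ε)) ∧ 0 ≤ ω t}).toReal)
      (nhdsWithin 0 (Set.Ioi 0)) (nhds 1) := by
  set b := 2 + ε + (x + 1) ^ 2 with hb
  have hb2 : 2 + ε ≤ b := by linarith [sq_nonneg (x + 1)]
  set M := 1 + 2 * b with hM
  have hM0 : 0 ≤ M := by linarith
  have hxM : -M ≤ x := by nlinarith [sq_nonneg (x + 1)]
  set δ := ε / 5 with hδ
  have hδ0 : 0 < δ := by positivity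
  set err : ℝ → ℝ := fun L => (6 * M * L + 12) * Real.exp (-1 * L ^ 2)
    + Real.exp (-δ * L ^ 2 + (2 + 3 * M) * L + 15 / 2) with herr
  have herr0 : Tendsto err atTop (nhds 0) := by
    simpa only [add_zero] using (tendsto_linear_mul_exp_neg_sq (δ := 1) (a := 6 * M) (b := 12)
      one_pos (by positivity) (by norm_num)).add (tendsto_exp_neg_sq_add hδ0 (2 + 3 * M) (15 / 2))
  have hinv : Tendsto (fun σ : ℝ => σ⁻¹) (nhdsWithin 0 (Set.Ioi 0)) atTop :=
    tendsto_inv_nhdsGT_zero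
  have hcmp : ∀ᶠ L : ℝ in atTop,
      (2 * 3 ^ (1 + ε) * M * L + 4 * 3 ^ (1 + ε)) * Real.exp (-δ * L ^ 2) < 1 :=
    (tendsto_linear_mul_exp_neg_sq hδ0 (by positivity) (by positivity)).eventually_lt_const one_pos
  have hlow : ∀ᶠ σ : ℝ in nhdsWithin 0 (Set.Ioi 0), 1 - err σ⁻¹
      ≤ (P σ {ω | ∃ t : ℕ, 0 < t ∧ (t : ℝ) < PhiHalf σ ^ (-(1 + ε)) ∧ 0 ≤ ω t}).toReal := by
    filter_upwards [hinv.eventually hcmp, self_mem_nhdsWithin,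
      nhdsWithin_le_nhds (Iio_mem_nhds (show (0 : ℝ) < 1 / 10 by norm_num))] with σ hcmpσ hσ hσ1
    rw [Set.mem_Ioi] at hσ
    rw [Set.mem_Iio] at hσ1
    have := (hP σ hσ).1
    set L := σ⁻¹ with hL
    have hL0 : 0 < L := inv_pos.2 hσ
    set n := ⌈M * L⌉₊ with hn
    set G := Real.exp ((2 / 5 + δ) * L ^ 2) with hG
    set k := ⌈G⌉₊ with hk
    have hn1 : M * L ≤ n := Nat.le_ceil _
    have hn2 : (n : ℝ) ≤ M * L + 1 := (Nat.ceil_lt_add_one (by positivity)).le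
    have hG1 : 1 ≤ G := Real.one_le_exp (by positivity)
    have hk1 : G ≤ k := Nat.le_ceil _
    have hk2 : (k : ℝ) ≤ 2 * G := by linarith [Nat.ceil_lt_add_one (show 0 ≤ G by linarith)]
    have hk0 : 0 < k := Nat.ceil_pos.2 (by linarith)
    have hT : ((n + 1) * k : ℝ) ≤ (M * L + 2) * (2 * G) :=
      mul_le_mul (by linarith) hk2 (by positivity) (by positivity)
    have hTlt : ((n + 1) * k : ℝ) < PhiHalf σ ^ (-(1 + ε)) := by
      refine hT.trans_lt (lt_of_lt_of_le ?_ (le_PhiHalf_rpow hσ (by linarith) hε))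
      have hsplit : Real.exp ((2 / 5 + 2 / 5 * ε) * L ^ 2) = G * Real.exp (δ * L ^ 2) := by
        rw [hG, ← Real.exp_add, hδ]
        ring_nf
      rw [neg_mul, Real.exp_neg, ← div_eq_mul_inv, div_lt_one (Real.exp_pos _)] at hcmpσ
      rw [hsplit, ← div_eq_inv_mul, lt_div_iff₀ (by positivity)]
      calc _ = G * (2 * 3 ^ (1 + ε) * M * L + 4 * 3 ^ (1 + ε)) := by ring
        _ < _ := by gcongr
    have hbound := toReal_staysNegative_le hσ hσ1 hx (by linarith) hxM (hP σ hσ) hk0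
      (n := n) (by
        rw [hL, ← div_eq_mul_inv, div_le_iff₀ hσ] at hn1
        exact hn1)
    have herr1 : ((n + 1) * k : ℝ) * (3 * Real.exp (((x + 1) ^ 2 / 2 - b ^ 2) / σ ^ 2))
        ≤ (6 * M * L + 12) * Real.exp (-1 * L ^ 2) := by
      have hexp : G * Real.exp (((x + 1) ^ 2 / 2 - b ^ 2) / σ ^ 2) ≤ Real.exp (-1 * L ^ 2) := by
        rw [hG, ← Real.exp_add, div_eq_mul_inv _ (σ ^ 2), ← inv_pow, ← hL, ← add_mul]
        gcongr
        nlinarith [sq_nonneg (x + 1)]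
      calc _ ≤ (M * L + 2) * (2 * G) * (3 * Real.exp (((x + 1) ^ 2 / 2 - b ^ 2) / σ ^ 2)) := by
            gcongr
        _ = (6 * M * L + 12) * (G * Real.exp (((x + 1) ^ 2 / 2 - b ^ 2) / σ ^ 2)) := by ring
        _ ≤ _ := by gcongr
    have herr2 : 1 / (k * Real.exp (-(2 / 5) / σ ^ 2 - 2 / σ - 3 * n - 9 / 2))
        ≤ Real.exp (-δ * L ^ 2 + (2 + 3 * M) * L + 15 / 2) := by
      rw [div_le_iff₀ (by positivity)]
      calc 1 ≤ Real.exp (-δ * L ^ 2 + (2 + 3 * M) * L + 15 / 2)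
            * (G * Real.exp (-(2 / 5) / σ ^ 2 - 2 / σ - 3 * n - 9 / 2)) := by
            rw [hG, ← Real.exp_add, ← Real.exp_add]
            refine Real.one_le_exp ?_
            rw [div_eq_mul_inv _ (σ ^ 2), div_eq_mul_inv _ σ, ← inv_pow, ← hL]
            linarith
        _ ≤ _ := by gcongr
    have hstay : (P σ (staysNegative ((n + 1) * k))).toReal ≤ err L :=
      hbound.trans (add_le_add herr1 herr2)
    have hcompl : 1 - (P σ (staysNegative ((n + 1) * k))).toReal
        = (P σ (staysNegative ((n + 1) * k))ᶜ).toReal :=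
      (probReal_compl_eq_one_sub (measurableSet_staysNegative _)).symm
    refine (sub_le_sub_left hstay 1).trans (hcompl.le.trans ?_)
    refine ENNReal.toReal_mono (measure_ne_top _ _) (measure_mono fun ω hω => ?_)
    simp only [staysNegative, Set.mem_compl_iff, Set.mem_ofPred_eq, not_forall, not_lt] at hω
    obtain ⟨t, ht0, htT, hωt⟩ := hω
    refine ⟨t, ht0, lt_of_le_of_lt ?_ hTlt, hωt⟩
    exact_mod_cast htT
  have hhigh : ∀ᶠ σ : ℝ in nhdsWithin 0 (Set.Ioi 0),
      (P σ {ω | ∃ t : ℕ, 0 < t ∧ (t : ℝ) < PhiHalf σ ^ (-(1 + ε)) ∧ 0 ≤ ω t}).toReal ≤ 1 := by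
    filter_upwards [self_mem_nhdsWithin] with σ hσ
    have := (hP σ hσ).1
    exact measureReal_le_one
  refine tendsto_of_tendsto_of_tendsto_of_le_of_le' ?_ tendsto_const_nhds hlow hhigh
  simpa using (herr0.comp hinv).const_sub 1
end

section
/- There exists σ₀ > 0 such that for all 0 < σ < σ₀ and all x < −10σ, the second derivative of −log f_σ at x satisfies (−log f_σ)''(x) ≥ 1/(8σ²); that is, f_σ is strongly log-concave on (−∞,−10σ) with parameter 1/(8σ²). -/
open MeasureTheory Filter Set

/-- The mixture density is a Gaussian factor times a hyperbolic cosine. -/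
theorem mixDensity_eq_exp_mul_cosh {σ : ℝ} (hσ : σ ≠ 0) (x : ℝ) :
    mixDensity σ x = (Real.sqrt (2 * Real.pi * σ ^ 2))⁻¹ *
      (Real.exp (-(x ^ 2 + 1) / (2 * σ ^ 2)) * Real.cosh (x / σ ^ 2)) := by
  have h₁ : -(x + 1) ^ 2 / (2 * σ ^ 2) = -(x ^ 2 + 1) / (2 * σ ^ 2) + -(x / σ ^ 2) := by
    field_simp
    ring
  have h₂ : -(x - 1) ^ 2 / (2 * σ ^ 2) = -(x ^ 2 + 1) / (2 * σ ^ 2) + x / σ ^ 2 := by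
    field_simp
    ring
  rw [mixDensity, gaussDensity, gaussDensity, h₁, h₂, Real.exp_add, Real.exp_add, Real.cosh_eq]
  ring

theorem neg_log_mixDensity {σ : ℝ} (hσ : σ ≠ 0) (x : ℝ) :
    -Real.log (mixDensity σ x) = -Real.log (Real.sqrt (2 * Real.pi * σ ^ 2))⁻¹ +
      ((x ^ 2 + 1) / (2 * σ ^ 2) - Real.log (Real.cosh (x / σ ^ 2))) := by
  have hc : Real.cosh (x / σ ^ 2) ≠ 0 := (Real.cosh_pos _).ne'
  have hs : (Real.sqrt (2 * Real.pi * σ ^ 2))⁻¹ ≠ 0 := by positivity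
  rw [mixDensity_eq_exp_mul_cosh hσ, Real.log_mul hs (mul_ne_zero (Real.exp_ne_zero _) hc),
    Real.log_mul (Real.exp_ne_zero _) hc, Real.log_exp]
  ring

theorem hasDerivAt_neg_log_mixDensity {σ : ℝ} (hσ : σ ≠ 0) (x : ℝ) :
    HasDerivAt (fun y => -Real.log (mixDensity σ y))
      (x / σ ^ 2 - Real.sinh (x / σ ^ 2) / Real.cosh (x / σ ^ 2) / σ ^ 2) x := by
  rw [funext (neg_log_mixDensity hσ)]
  have hc : Real.cosh (x / σ ^ 2) ≠ 0 := (Real.cosh_pos _).ne'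
  have hq := (((hasDerivAt_id x).pow 2).add_const 1).div_const (2 * σ ^ 2)
  have hl := (((hasDerivAt_id x).div_const (σ ^ 2)).cosh).log hc
  refine ((hq.sub hl).const_add _).congr_deriv ?_
  simp only [id]
  field_simp
  norm_num
  ring

theorem deriv_deriv_neg_log_mixDensity {σ : ℝ} (hσ : σ ≠ 0) (x : ℝ) :
    deriv (deriv (fun y => -Real.log (mixDensity σ y))) x =
      1 / σ ^ 2 - 1 / (σ ^ 4 * Real.cosh (x / σ ^ 2) ^ 2) := by
  rw [funext fun y => (hasDerivAt_neg_log_mixDensity hσ y).deriv]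
  have hc : Real.cosh (x / σ ^ 2) ≠ 0 := (Real.cosh_pos _).ne'
  have ht := (hasDerivAt_id x).div_const (σ ^ 2)
  refine ((ht.sub ((ht.sinh.div ht.cosh hc).div_const (σ ^ 2))).congr_deriv ?_).deriv
  simp only [id]
  field_simp
  rw [Real.cosh_sq]
  ring

theorem sq_le_cosh_sq (t : ℝ) : t ^ 2 ≤ Real.cosh t ^ 2 := by
  have h : |t| ≤ |Real.sinh t| := by
    rw [Real.abs_sinh]
    exact Real.self_le_sinh_iff.2 (abs_nonneg t)
  have := sq_le_sq.2 h
  rw [Real.cosh_sq]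
  linarith

/-- Strong log-concavity of the mixture density on `(-∞, -10σ)` with parameter `1/(8σ²)`. -/
theorem stmt10 :
    ∃ σ₀ : ℝ, 0 < σ₀ ∧ ∀ σ : ℝ, 0 < σ → σ < σ₀ →
      ∀ x : ℝ, x < -(10 * σ) →
        1 / (8 * σ ^ 2) ≤ deriv (deriv (fun y => -Real.log (mixDensity σ y))) x := by
  refine ⟨1, one_pos, fun σ hσ _ x hx => ?_⟩
  rw [deriv_deriv_neg_log_mixDensity hσ.ne']
  have hx2 : 100 * σ ^ 2 ≤ x ^ 2 := by nlinarith
  have hcosh : 100 * σ ^ 2 ≤ σ ^ 4 * Real.cosh (x / σ ^ 2) ^ 2 := by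
    calc 100 * σ ^ 2 ≤ x ^ 2 := hx2
      _ = σ ^ 4 * (x / σ ^ 2) ^ 2 := by field_simp
      _ ≤ _ := by gcongr ?_ * ?_; exact sq_le_cosh_sq _
  have h := one_div_le_one_div_of_le (by positivity) hcosh
  have h8 : 1 / (8 * σ ^ 2) = 1 / 8 * (1 / σ ^ 2) := by field_simp
  have h100 : 1 / (100 * σ ^ 2) = 1 / 100 * (1 / σ ^ 2) := by field_simp
  have hpos : 0 < 1 / σ ^ 2 := by positivity
  linarith
end
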